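/- Let T ∈ L(c₀;Y) be a nonzero operator whose support is finite, i.e., T∘(I − P_B) = 0 for some finite set B ⊂ ℕ. Then no operator S ∈ L(c₀;Y) with ‖S − T‖ < ‖T‖/2 has the Bhatia–Šemrl property. -/

import Mathlib

noncomputable section

/-- `x` is Birkhoff--James orthogonal to `y`: `‖x‖ ≤ ‖x + a • y‖` for every scalar `a`. -/
def BJOrth (𝕂 : Type*) [RCLike 𝕂] {E : Type*} [NormedAddCommGroup E] [NormedSpace 𝕂 E]
    (x y : E) : Prop :=
  ∀ a : 𝕂, ‖x‖ ≤ ‖x + a • y‖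

/-- The Bhatia--Šemrl property for bounded linear operators: whenever `T ⊥_B S` there is a
norm attaining point `x` of `T` with `T x ⊥_B S x`. -/
def HasBSProp (𝕂 : Type*) [RCLike 𝕂] {X Y : Type*} [NormedAddCommGroup X] [NormedSpace 𝕂 X]
    [NormedAddCommGroup Y] [NormedSpace 𝕂 Y] (T : X →L[𝕂] Y) : Prop :=
  ∀ S : X →L[𝕂] Y, BJOrth 𝕂 T S →
    ∃ x : X, ‖x‖ = 1 ∧ ‖T x‖ = ‖T‖ ∧ BJOrth 𝕂 (T x) (S x)

open scoped ZeroAtInfty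

/-- The element of `c₀` obtained from `f` by keeping the coordinates in the finite set `A`
and setting the others to `0`. -/
def projFun {𝕂 : Type*} [RCLike 𝕂] (A : Finset ℕ) (f : C₀(ℕ, 𝕂)) : C₀(ℕ, 𝕂) where
  toFun n := if n ∈ A then f n else 0
  continuous_toFun := continuous_of_discreteTopology
  zero_at_infty' := by
    rw [Filter.cocompact_eq_cofinite]
    refine Filter.Tendsto.congr' ?_ tendsto_const_nhds
    have h : {n : ℕ | ¬ (0 : 𝕂) = if n ∈ A then f n else 0}.Finite := by
      apply (A : Set ℕ).toFinite.subset
      intro n hn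
      simp only [Set.mem_setOf_eq] at hn
      by_contra hA
      rw [Finset.mem_coe] at hA
      exact hn (by rw [if_neg hA])
    exact Filter.eventually_cofinite.mpr h

lemma projFun_norm_le {𝕂 : Type*} [RCLike 𝕂] (A : Finset ℕ) (f : C₀(ℕ, 𝕂)) :
    ‖projFun A f‖ ≤ ‖f‖ := by
  rw [← ZeroAtInftyContinuousMap.norm_toBCF_eq_norm, ← ZeroAtInftyContinuousMap.norm_toBCF_eq_norm]
  refine (BoundedContinuousFunction.norm_le (norm_nonneg _)).mpr fun n => ?_
  show ‖if n ∈ A then f n else 0‖ ≤ _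
  split
  · exact BoundedContinuousFunction.norm_coe_le_norm f.toBCF n
  · simp

/-- The canonical projection `P_A : c₀ → c₀` onto the coordinates in a finite set `A ⊆ ℕ`. -/
def projC0 (𝕂 : Type*) [RCLike 𝕂] (A : Finset ℕ) : C₀(ℕ, 𝕂) →L[𝕂] C₀(ℕ, 𝕂) :=
  LinearMap.mkContinuous
    { toFun := projFun A
      map_add' := fun f g => by
        ext n
        show (if n ∈ A then (f + g) n else 0)
          = (if n ∈ A then f n else 0) + (if n ∈ A then g n else 0)
        split <;> simp
      map_smul' := fun c f => by
        ext n
        show (if n ∈ A then (c • f) n else 0) = c • (if n ∈ A then f n else 0)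
        split <;> simp }
    1 (fun f => by simpa using projFun_norm_le A f)

section Orthogonality

variable {𝕂 : Type*} [RCLike 𝕂]

lemma eq_zero_of_norm_add_le_of_norm_sub_le {a b : 𝕂} (hadd : ‖a + b‖ ≤ ‖a‖)
    (hsub : ‖a - b‖ ≤ ‖a‖) : b = 0 := by
  have h := parallelogram_law_with_norm_mul 𝕂 a b
  have h₁ := mul_self_le_mul_self (norm_nonneg _) hadd
  have h₂ := mul_self_le_mul_self (norm_nonneg _) hsub
  have : ‖b‖ * ‖b‖ ≤ 0 := by linarith
  exact norm_eq_zero.mp (mul_self_eq_zero.mp (le_antisymm this (mul_self_nonneg _)))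

/-- The James characterization of Birkhoff--James orthogonality by supporting functionals. -/
lemma BJOrth.exists_dual {E : Type*} [NormedAddCommGroup E] [NormedSpace 𝕂 E] {x y : E}
    (h : BJOrth 𝕂 x y) : ∃ f : StrongDual 𝕂 E, ‖f‖ ≤ 1 ∧ f x = (‖x‖ : 𝕂) ∧ f y = 0 := by
  let V : Submodule 𝕂 E := 𝕂 ∙ y
  have hmk : ∀ z : E, ‖V.mkQL z‖ ≤ ‖z‖ := fun z => Submodule.Quotient.norm_mk_le V z
  have hle : ‖x‖ ≤ ‖V.mkQL x‖ := by
    refine QuotientAddGroup.le_norm_iff.mpr fun m hm => ?_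
    have hm' : m - x ∈ V := (Submodule.Quotient.eq V).mp hm
    obtain ⟨a, ha⟩ := Submodule.mem_span_singleton.mp hm'
    simpa [ha] using h a
  obtain ⟨g, hg, hgx⟩ := exists_dual_vector'' 𝕂 (V.mkQL x)
  refine ⟨g.comp V.mkQL, ?_, ?_, ?_⟩
  · refine ContinuousLinearMap.opNorm_le_bound _ zero_le_one fun z => ?_
    exact (g.le_of_opNorm_le hg _).trans (by simpa using hmk z)
  · rw [le_antisymm (hmk x) hle] at hgx
    exact hgx
  · have : V.mkQL y = 0 :=
      (Submodule.Quotient.mk_eq_zero V).mpr (Submodule.mem_span_singleton_self y)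
    simp [this]

end Orthogonality

section CZero

variable {𝕂 : Type*} [RCLike 𝕂]

lemma norm_apply_le_norm (x : C₀(ℕ, 𝕂)) (n : ℕ) : ‖x n‖ ≤ ‖x‖ := by
  rw [← ZeroAtInftyContinuousMap.norm_toBCF_eq_norm]
  exact x.toBCF.norm_coe_le_norm n

lemma norm_le_of_forall_apply_le {x : C₀(ℕ, 𝕂)} {r : ℝ} (hr : 0 ≤ r) (h : ∀ n, ‖x n‖ ≤ r) :
    ‖x‖ ≤ r := by
  rw [← ZeroAtInftyContinuousMap.norm_toBCF_eq_norm]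
  exact (BoundedContinuousFunction.norm_le hr).mpr h

/-- The sequence with value `a` at `n` and `0` elsewhere. -/
def c0Single (n : ℕ) (a : 𝕂) : C₀(ℕ, 𝕂) where
  toFun := Pi.single n a
  continuous_toFun := continuous_of_discreteTopology
  zero_at_infty' := by
    rw [Filter.cocompact_eq_cofinite]
    refine (tendsto_const_nhds (x := (0 : 𝕂))).congr' (Filter.eventually_cofinite.mpr ?_)
    refine (Set.finite_singleton n).subset fun m hm => ?_
    by_contra hmn
    exact hm (Pi.single_eq_of_ne (M := fun _ => 𝕂) hmn a).symm

lemma c0Single_apply (n m : ℕ) (a : 𝕂) : c0Single n a m = if m = n then a else 0 :=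
  Pi.single_apply n a m

lemma projC0_apply (A : Finset ℕ) (x : C₀(ℕ, 𝕂)) (n : ℕ) :
    projC0 𝕂 A x n = if n ∈ A then x n else 0 := rfl

lemma projC0_c0Single {A : Finset ℕ} {n : ℕ} (hn : n ∉ A) (a : 𝕂) :
    projC0 𝕂 A (c0Single n a) = 0 := by
  ext m
  rw [projC0_apply, c0Single_apply]
  by_cases hm : m = n <;> simp [hm, hn]

lemma norm_sub_projC0_le (A : Finset ℕ) (x : C₀(ℕ, 𝕂)) : ‖x - projC0 𝕂 A x‖ ≤ ‖x‖ := by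
  refine norm_le_of_forall_apply_le (norm_nonneg _) fun n => ?_
  rw [ZeroAtInftyContinuousMap.sub_apply, projC0_apply]
  split
  · simp
  · simpa using norm_apply_le_norm x n

/-- Far out, a vector of the unit ball of `c₀` can be moved in both directions along a coordinate
without leaving the ball. -/
lemma exists_c0Single_add_sub_mem_ball (A : Finset ℕ) {x : C₀(ℕ, 𝕂)} (hx : ‖x‖ ≤ 1) :
    ∃ n ∉ A, ‖x + c0Single n (1 / 2)‖ ≤ 1 ∧ ‖x - c0Single n (1 / 2)‖ ≤ 1 := by
  have hlim : Filter.Tendsto x Filter.cofinite (nhds 0) := by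
    rw [← Filter.cocompact_eq_cofinite]
    exact x.zero_at_infty'
  have hsmall : ∀ᶠ n in Filter.cofinite, ‖x n‖ < 1 / 2 := by
    simpa using hlim.eventually (Metric.ball_mem_nhds 0 (by norm_num : (0 : ℝ) < 1 / 2))
  have hout : ∀ᶠ n in Filter.cofinite, n ∉ A :=
    Filter.eventually_cofinite.mpr (by simp)
  obtain ⟨n, hn, hnA⟩ := (hsmall.and hout).exists
  have hhalf : ‖(1 / 2 : 𝕂)‖ = 1 / 2 := by simp
  refine ⟨n, hnA, norm_le_of_forall_apply_le zero_le_one fun m => ?_,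
    norm_le_of_forall_apply_le zero_le_one fun m => ?_⟩
  · rw [ZeroAtInftyContinuousMap.add_apply, c0Single_apply]
    split_ifs with hm
    · subst hm
      linarith [norm_add_le (x m) (1 / 2 : 𝕂)]
    · simpa using (norm_apply_le_norm x m).trans hx
  · rw [ZeroAtInftyContinuousMap.sub_apply, c0Single_apply]
    split_ifs with hm
    · subst hm
      linarith [norm_sub_le (x m) (1 / 2 : 𝕂)]
    · simpa using (norm_apply_le_norm x m).trans hx

lemma exists_dual_c0Single_ne_zero :
    ∃ g : StrongDual 𝕂 C₀(ℕ, 𝕂), ∀ n, ∀ a : 𝕂, a ≠ 0 → g (c0Single n a) ≠ 0 := by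
  have hbound : ∀ (x : C₀(ℕ, 𝕂)) (n : ℕ), ‖(1 / 2 : 𝕂) ^ n * x n‖ ≤ (1 / 2 : ℝ) ^ n * ‖x‖ := by
    intro x n
    rw [norm_mul, norm_pow]
    have hhalf : ‖(1 / 2 : 𝕂)‖ = 1 / 2 := by simp
    rw [hhalf]
    gcongr
    exact norm_apply_le_norm x n
  have hgeom : ∀ x : C₀(ℕ, 𝕂), HasSum (fun n : ℕ => (1 / 2 : ℝ) ^ n * ‖x‖) (2 * ‖x‖) := fun x =>
    hasSum_geometric_two.mul_right _
  have hsum : ∀ x : C₀(ℕ, 𝕂), Summable fun n : ℕ => (1 / 2 : 𝕂) ^ n * x n := fun x =>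
    Summable.of_norm_bounded (hgeom x).summable (hbound x)
  let g : C₀(ℕ, 𝕂) →ₗ[𝕂] 𝕂 :=
    { toFun := fun x => ∑' n : ℕ, (1 / 2 : 𝕂) ^ n * x n
      map_add' := fun x y => by
        rw [← (hsum x).tsum_add (hsum y)]
        exact tsum_congr fun n => mul_add _ _ _
      map_smul' := fun c x => by
        rw [RingHom.id_apply, smul_eq_mul, ← tsum_mul_left]
        exact tsum_congr fun n => mul_left_comm _ _ _ }
  refine ⟨g.mkContinuous 2 fun x => tsum_of_norm_bounded (hgeom x) (hbound x), fun n a ha => ?_⟩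
  have hval : ∑' m : ℕ, (1 / 2 : 𝕂) ^ m * c0Single n a m = (1 / 2 : 𝕂) ^ n * a := by
    rw [tsum_eq_single n fun m hm => by simp [c0Single_apply, hm]]
    simp [c0Single_apply]
  change ∑' m : ℕ, (1 / 2 : 𝕂) ^ m * c0Single n a m ≠ 0
  rw [hval]
  exact mul_ne_zero (pow_ne_zero _ (by norm_num)) ha

end CZero

section FiniteSupport

variable {𝕂 Y : Type*} [RCLike 𝕂] [NormedAddCommGroup Y] [NormedSpace 𝕂 Y]

/-- Pairs of a vector and a functional in the unit balls at which the norm of `S` is attained. -/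
def normingPairs (S : C₀(ℕ, 𝕂) →L[𝕂] Y) : Set (C₀(ℕ, 𝕂) × StrongDual 𝕂 Y) :=
  {p | ‖p.1‖ ≤ 1 ∧ ‖p.2‖ ≤ 1 ∧ p.2 (S p.1) = (‖S‖ : 𝕂)}

lemma norm_apply_apply_le {R : C₀(ℕ, 𝕂) →L[𝕂] Y} {x : C₀(ℕ, 𝕂)} {f : StrongDual 𝕂 Y}
    (hx : ‖x‖ ≤ 1) (hf : ‖f‖ ≤ 1) : ‖f (R x)‖ ≤ ‖R‖ :=
  calc ‖f (R x)‖ ≤ 1 * ‖R x‖ := f.le_of_opNorm_le hf _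
    _ ≤ 1 * ‖R‖ := by gcongr; exact R.unit_le_opNorm x hx
    _ = ‖R‖ := one_mul _

lemma exists_normingPairs_perturbation {S : C₀(ℕ, 𝕂) →L[𝕂] Y} (A : Finset ℕ)
    {x : C₀(ℕ, 𝕂)} {f : StrongDual 𝕂 Y} (h : (x, f) ∈ normingPairs S) :
    ∃ n ∉ A, (x + c0Single n (1 / 2), f) ∈ normingPairs S ∧
      (x - c0Single n (1 / 2), f) ∈ normingPairs S := by
  obtain ⟨hx, hf, hfx⟩ := h
  obtain ⟨n, hn, hadd, hsub⟩ := exists_c0Single_add_sub_mem_ball A hx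
  dsimp only at hx hf hfx
  have hzero : f (S (c0Single n (1 / 2))) = 0 := by
    apply eq_zero_of_norm_add_le_of_norm_sub_le (a := f (S x))
    · rw [← map_add, ← map_add, hfx, RCLike.norm_ofReal, abs_of_nonneg S.opNorm_nonneg]
      exact norm_apply_apply_le hadd hf
    · rw [← map_sub, ← map_sub, hfx, RCLike.norm_ofReal, abs_of_nonneg S.opNorm_nonneg]
      exact norm_apply_apply_le hsub hf
  exact ⟨n, hn, ⟨hadd, hf, by rw [map_add, map_add, hzero, add_zero, hfx]⟩,
    ⟨hsub, hf, by rw [map_sub, map_sub, hzero, sub_zero, hfx]⟩⟩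

/-- An operator whose restriction to the coordinates outside some finite set has smaller norm
does not have the Bhatia--Šemrl property. -/
theorem not_hasBSProp_of_tail_lt {S : C₀(ℕ, 𝕂) →L[𝕂] Y} (B : Finset ℕ) {r : ℝ}
    (hr : r < ‖S‖) (htail : ∀ x, ‖x‖ ≤ 1 → ‖S (x - projC0 𝕂 B x)‖ ≤ r) :
    ¬ HasBSProp 𝕂 S := by
  intro hBS
  obtain ⟨x₀, hx₀, hSx₀, -⟩ := hBS 0 fun a => by simp
  obtain ⟨f₀, hf₀, hfx₀⟩ := exists_dual_vector'' 𝕂 (S x₀)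
  have hpair₀ : (x₀, f₀) ∈ normingPairs S := ⟨hx₀.le, hf₀, by simpa [hSx₀] using hfx₀⟩
  have hS : 0 < ‖S‖ := ((norm_nonneg _).trans (htail 0 (by simp))).trans_lt hr
  have hf₀y : f₀ (S x₀) ≠ 0 := by
    rw [hfx₀, hSx₀]
    exact RCLike.ofReal_ne_zero.mpr hS.ne'
  obtain ⟨g, hg⟩ := exists_dual_c0Single_ne_zero (𝕂 := 𝕂)
  let P := S.comp (projC0 𝕂 B)
  let G := g.smulRight (S x₀)
  let q : C₀(ℕ, 𝕂) × StrongDual 𝕂 Y → 𝕂 := fun p => p.2 (G p.1) / p.2 (P p.1)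
  have hP : ∀ p ∈ normingPairs S, ‖S‖ - r ≤ ‖p.2 (P p.1)‖ := by
    rintro ⟨x, f⟩ ⟨hx, hf, hfx⟩
    have h₁ : ‖f (S x)‖ = ‖S‖ := by
      rw [hfx, RCLike.norm_ofReal, abs_of_nonneg S.opNorm_nonneg]
    have h₂ : f (S x) = f (S (x - projC0 𝕂 B x)) + f (P x) := by simp [P]
    have h₃ : ‖f (S (x - projC0 𝕂 B x))‖ ≤ r :=
      ((f.le_of_opNorm_le hf _).trans_eq (one_mul _)).trans (htail x hx)
    have h₄ := norm_add_le (f (S (x - projC0 𝕂 B x))) (f (P x))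
    rw [← h₂, h₁] at h₄
    change ‖S‖ - r ≤ ‖f (P x)‖
    linarith
  have hP₀ : ∀ p ∈ normingPairs S, p.2 (P p.1) ≠ 0 := fun p hp =>
    norm_pos_iff.mp ((sub_pos.mpr hr).trans_le (hP p hp))
  have hbdd : Bornology.IsBounded (q '' normingPairs S) := by
    refine isBounded_iff_forall_norm_le.mpr ⟨‖G‖ / (‖S‖ - r), ?_⟩
    rintro _ ⟨p, hp, rfl⟩
    rw [norm_div]
    exact div_le_div₀ G.opNorm_nonneg (norm_apply_apply_le hp.1 hp.2.1) (sub_pos.mpr hr) (hP p hp)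
  obtain ⟨u, hu, hmax⟩ := hbdd.isCompact_closure.exists_isMaxOn
    (closure_nonempty_iff.mpr ⟨_, Set.mem_image_of_mem q hpair₀⟩) continuous_norm.continuousOn
  have hq_le : ∀ p ∈ normingPairs S, ‖q p‖ ≤ ‖u‖ := fun p hp =>
    hmax (subset_closure (Set.mem_image_of_mem q hp))
  have hq_ne : ∀ x f, (x, f) ∈ normingPairs S → f (S x₀) ≠ 0 → ‖u‖ ≤ ‖q (x, f)‖ → False := by
    intro x f hp hfy hle
    obtain ⟨n, hn, hadd, hsub⟩ := exists_normingPairs_perturbation B hp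
    have hPe : P (c0Single n (1 / 2)) = 0 := by simp [P, projC0_c0Single hn]
    have hGe : f (G (c0Single n (1 / 2))) / f (P x) = 0 := by
      apply eq_zero_of_norm_add_le_of_norm_sub_le (a := q (x, f))
      · refine le_trans (le_of_eq ?_) ((hq_le _ hadd).trans hle)
        simp only [q, map_add, hPe, add_zero, add_div]
      · refine le_trans (le_of_eq ?_) ((hq_le _ hsub).trans hle)
        simp only [q, map_sub, hPe, sub_zero, sub_div]
    refine div_ne_zero ?_ (hP₀ _ hp) hGe
    have hval : f (G (c0Single n (1 / 2))) = g (c0Single n (1 / 2)) * f (S x₀) := by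
      simp only [G, ContinuousLinearMap.smulRight_apply, map_smul, smul_eq_mul]
    rw [hval]
    exact mul_ne_zero (hg n (1 / 2) (by norm_num)) hfy
  have hu₀ : u ≠ 0 := by
    rintro rfl
    exact hq_ne x₀ f₀ hpair₀ hf₀y (by simp)
  let R := u • P - G
  have horth : BJOrth 𝕂 S R := by
    intro a
    have hclosed : IsClosed {z : 𝕂 | ‖S‖ ≤ ‖S + a • R‖ + ‖a‖ * (‖u - z‖ * ‖P‖)} :=
      isClosed_le continuous_const (by fun_prop)
    have hmem : u ∈ {z : 𝕂 | ‖S‖ ≤ ‖S + a • R‖ + ‖a‖ * (‖u - z‖ * ‖P‖)} := by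
      refine closure_minimal ?_ hclosed hu
      rintro _ ⟨⟨x, f⟩, hp, rfl⟩
      have hfR : f (R x) = (u - q (x, f)) * f (P x) := by
        have hne : f (P x) ≠ 0 := hP₀ _ hp
        have : q (x, f) * f (P x) = f (G x) := div_mul_cancel₀ _ hne
        simp [R, sub_mul, this]
      have hfS : (‖S‖ : 𝕂) = f ((S + a • R) x) - a * ((u - q (x, f)) * f (P x)) := by
        rw [← hfR, ← hp.2.2]
        simp
      calc ‖S‖ = ‖(‖S‖ : 𝕂)‖ := by
            rw [RCLike.norm_ofReal, abs_of_nonneg S.opNorm_nonneg]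
        _ ≤ ‖f ((S + a • R) x)‖ + ‖a * ((u - q (x, f)) * f (P x))‖ := by
          rw [hfS]
          exact norm_sub_le _ _
        _ ≤ ‖S + a • R‖ + ‖a‖ * (‖u - q (x, f)‖ * ‖P‖) := by
          rw [norm_mul, norm_mul]
          gcongr
          · exact norm_apply_apply_le hp.1 hp.2.1
          · exact norm_apply_apply_le hp.1 hp.2.1
    simpa using hmem
  obtain ⟨x, hx, hSx, hxR⟩ := hBS R horth
  obtain ⟨f, hf, hfx, hfR⟩ := hxR.exists_dual
  have hp : (x, f) ∈ normingPairs S := ⟨hx.le, hf, by rw [hfx, hSx]⟩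
  have hqu : q (x, f) = u := by
    refine (div_eq_iff (hP₀ _ hp)).mpr ?_
    have hsub : u * f (P x) - f (G x) = 0 := by simpa [R] using hfR
    exact (sub_eq_zero.mp hsub).symm
  refine hq_ne x f hp (fun hfy => hu₀ ?_) (by rw [hqu])
  rw [← hqu]
  simp [q, G, hfy]

end FiniteSupport

/-- If `T : c₀ → Y` is a nonzero operator with finite support, then no operator within
distance `‖T‖ / 2` of `T` has the Bhatia--Šemrl property. -/
theorem not_BS_near_finitely_supported {𝕂 Y : Type*} [RCLike 𝕂]
    [NormedAddCommGroup Y] [NormedSpace 𝕂 Y] [CompleteSpace Y]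
    (T : C₀(ℕ, 𝕂) →L[𝕂] Y) (hT : T ≠ 0) (B : Finset ℕ)
    (hsupp : T.comp (ContinuousLinearMap.id 𝕂 C₀(ℕ, 𝕂) - projC0 𝕂 B) = 0)
    (S : C₀(ℕ, 𝕂) →L[𝕂] Y) (hS : ‖S - T‖ < ‖T‖ / 2) :
    ¬ HasBSProp 𝕂 S := by
  have hlt : ‖S - T‖ < ‖S‖ := by
    have : ‖T‖ ≤ ‖S‖ + ‖S - T‖ := norm_le_insert S T
    linarith
  refine not_hasBSProp_of_tail_lt B hlt fun x hx => ?_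
  have hTx : T (x - projC0 𝕂 B x) = 0 := by simpa using DFunLike.congr_fun hsupp x
  have hSx : S (x - projC0 𝕂 B x) = (S - T) (x - projC0 𝕂 B x) := by
    rw [sub_apply, hTx, sub_zero]
  rw [hSx]
  exact (S - T).unit_le_opNorm _ ((norm_sub_projC0_le B x).trans hx)
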